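/- arXiv:1911.03652 — 5 statements merged into one kernel-verified Lean document; each statement's English description precedes it below -/
import Mathlib

section
/- Let x ∈ ℝ² satisfy δ₀(x) ≠ 0 and det(g(x),[g,[f,g]](x)) ≠ 0, and let p ∈ ℝ² be nonzero with p·g(x) = 0. Then p·f(x) ≠ 0, p·[g,[f,g]](x) ≠ 0, and the singular-control value satisfies the feedback formula −(p·[f,[f,g]](x))/(p·[g,[f,g]](x)) = ψ(x). -/
open scoped RealInnerProductSpace

noncomputable section

/-- The plane, with its Euclidean (inner product) structure. -/
abbrev E2 : Type := EuclideanSpace ℝ (Fin 2)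

/-- `det(a,b) = a₁b₂ − a₂b₁`. -/
def det2 (a b : E2) : ℝ := a 0 * b 1 - a 1 * b 0

/-- Lie bracket `[f,g](x) = Dg(x)f(x) − Df(x)g(x)`. -/
def lieB (f g : E2 → E2) (x : E2) : E2 :=
  fderiv ℝ g x (f x) - fderiv ℝ f x (g x)

/-- The singular feedback control
`ψ(x) = −det(g(x),[f,[f,g]](x))/det(g(x),[g,[f,g]](x))`. -/
def ψfb (f g : E2 → E2) (x : E2) : ℝ :=
  -det2 (g x) (lieB f (lieB f g) x) / det2 (g x) (lieB g (lieB f g) x)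

theorem real_inner_eq_sum (a b : E2) : ⟪a, b⟫ = a 0 * b 0 + a 1 * b 1 := by
  simp [PiLp.inner_apply, Fin.sum_univ_two, mul_comm]

/-- A nonzero covector annihilating a nonzero `a` is a nonzero multiple of `det2 a`. -/
theorem exists_inner_eq_mul_det2 {p a : E2} (hp : p ≠ 0) (ha : a ≠ 0) (h : ⟪p, a⟫ = 0) :
    ∃ c : ℝ, c ≠ 0 ∧ ∀ v : E2, ⟪p, v⟫ = c * det2 a v := by
  have hn : a 0 * a 0 + a 1 * a 1 ≠ 0 := by
    rw [← real_inner_eq_sum]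
    exact inner_self_ne_zero.mpr ha
  have key : ∀ v : E2, ⟪p, v⟫ = det2 a p / (a 0 * a 0 + a 1 * a 1) * det2 a v := by
    intro v
    rw [real_inner_eq_sum] at h ⊢
    rw [div_mul_eq_mul_div, eq_div_iff hn]
    unfold det2
    linear_combination (a 0 * v 0 + a 1 * v 1) * h
  refine ⟨_, fun hc => hp ?_, key⟩
  have hpp := key p
  rw [hc, zero_mul] at hpp
  exact inner_self_eq_zero.mp hpp

/-- if `δ₀(x) ≠ 0`, `det(g(x),[g,[f,g]](x)) ≠ 0`, and `p ≠ 0` with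
`p·g(x) = 0`, then `p·f(x) ≠ 0`, `p·[g,[f,g]](x) ≠ 0`, and
`−(p·[f,[f,g]](x))/(p·[g,[f,g]](x)) = ψ(x)`. -/
theorem stmt1 (f g : E2 → E2)
    (hf : ContDiff ℝ (⊤ : ℕ∞) f) (hg : ContDiff ℝ (⊤ : ℕ∞) g)
    (x p : E2) (hδ : det2 (f x) (g x) ≠ 0)
    (hB : det2 (g x) (lieB g (lieB f g) x) ≠ 0)
    (hp0 : p ≠ 0) (hp : ⟪p, g x⟫ = 0) :
    ⟪p, f x⟫ ≠ 0 ∧ ⟪p, lieB g (lieB f g) x⟫ ≠ 0 ∧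
    -⟪p, lieB f (lieB f g) x⟫ / ⟪p, lieB g (lieB f g) x⟫ = ψfb f g x := by
  have hg0 : g x ≠ 0 := fun h => hδ (by simp [det2, h])
  obtain ⟨c, hc, key⟩ := exists_inner_eq_mul_det2 hp0 hg0 hp
  refine ⟨?_, ?_, ?_⟩
  · rw [key]
    refine mul_ne_zero hc fun h => hδ ?_
    unfold det2 at h ⊢
    linear_combination -h
  · rw [key]
    exact mul_ne_zero hc hB
  · rw [key, key, ψfb, ← mul_neg, mul_div_mul_left _ _ hc]
end
end

section
/- On the open set {x ∈ ℝ² : δ₀(x) ≠ 0}, the function α(x) := −det(g(x),[f,g](x))/δ₀(x) is C^∞, and for every x in this set with δ_SA(x) = 0 (i.e. x ∈ Δ_SA \ Δ₀) one has det(g(x),[g,[f,g]](x)) = −δ₀(x)·(∇α(x)·g(x)) and det(g(x),[f,[f,g]](x)) = −δ₀(x)·(∇α(x)·f(x)). -/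
open scoped RealInnerProductSpace

noncomputable section

/-- The coefficient `α(x) = −det(g(x),[f,g](x))/δ₀(x)`. -/
def αfun (f g : E2 → E2) (x : E2) : ℝ :=
  -det2 (g x) (lieB f g x) / det2 (f x) (g x)

lemma contDiff_lieB {f g : E2 → E2}
    (hf : ContDiff ℝ (⊤ : ℕ∞) f) (hg : ContDiff ℝ (⊤ : ℕ∞) g) :
    ContDiff ℝ (⊤ : ℕ∞) (lieB f g) :=
  ((hg.fderiv_right le_rfl).clm_apply hf).sub ((hf.fderiv_right le_rfl).clm_apply hg)

lemma contDiff_det2 {a b : E2 → E2}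
    (ha : ContDiff ℝ (⊤ : ℕ∞) a) (hb : ContDiff ℝ (⊤ : ℕ∞) b) :
    ContDiff ℝ (⊤ : ℕ∞) (fun x => det2 (a x) (b x)) := by
  have ha' := contDiff_euclidean.1 ha
  have hb' := contDiff_euclidean.1 hb
  exact ((ha' 0).mul (hb' 1)).sub ((ha' 1).mul (hb' 0))

lemma fderiv_det2_apply {a b : E2 → E2} {x : E2}
    (ha : DifferentiableAt ℝ a x) (hb : DifferentiableAt ℝ b x) (v : E2) :
    fderiv ℝ (fun y => det2 (a y) (b y)) x v
      = det2 (fderiv ℝ a x v) (b x) + det2 (a x) (fderiv ℝ b x v) := by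
  have ha' := fun i => (EuclideanSpace.proj (𝕜 := ℝ) i).hasFDerivAt.comp x ha.hasFDerivAt
  have hb' := fun i => (EuclideanSpace.proj (𝕜 := ℝ) i).hasFDerivAt.comp x hb.hasFDerivAt
  have h : HasFDerivAt (fun y => det2 (a y) (b y)) _ x :=
    ((ha' 0).mul (hb' 1)).sub ((ha' 1).mul (hb' 0))
  rw [h.fderiv]
  simp [det2]
  ring

/-- At a zero of the numerator, only the numerator contributes to the derivative of a quotient. -/
lemma mul_fderiv_neg_div_apply {S d : E2 → ℝ} {x : E2}
    (hS : DifferentiableAt ℝ S x) (hd : DifferentiableAt ℝ d x)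
    (hdx : d x ≠ 0) (hSx : S x = 0) (v : E2) :
    -d x * fderiv ℝ (fun y => -S y / d y) x v = fderiv ℝ S x v := by
  have hq : DifferentiableAt ℝ (fun y => -S y / d y) x := by
    simp only [div_eq_mul_inv]
    exact hS.fun_neg.fun_mul (hd.fun_inv hdx)
  have hEq : (fun y => -S y / d y * d y) =ᶠ[nhds x] fun y => -S y := by
    filter_upwards [hd.continuousAt.eventually_ne hdx] with y hy
    exact div_mul_cancel₀ _ hy
  have h := hEq.fderiv_eq (𝕜 := ℝ)
  rw [fderiv_fun_mul hq hd, fderiv_fun_neg] at h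
  have hv := DFunLike.congr_fun h v
  simp [hSx] at hv
  linarith

/-- In the plane, a vector parallel to a nonzero vector is a multiple of it. -/
lemma exists_eq_smul_of_det2_eq_zero {a b c : E2} (hab : det2 a b ≠ 0) (hbc : det2 b c = 0) :
    ∃ r : ℝ, c = r • b := by
  refine ⟨det2 a c / det2 a b, ?_⟩
  ext i
  rw [PiLp.smul_apply, smul_eq_mul, div_mul_eq_mul_div, eq_div_iff hab]
  unfold det2 at *
  fin_cases i
  · simp only [Fin.zero_eta]
    linear_combination -a 0 * hbc
  · simp only [Fin.mk_one]
    linear_combination -a 1 * hbc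

/-- on `{δ₀ ≠ 0}` the function `α` is `C^∞`, and at every point of
this set where `δ_SA` vanishes one has
`det(g,[g,[f,g]]) = −δ₀·(∇α·g)` and `det(g,[f,[f,g]]) = −δ₀·(∇α·f)`. -/
theorem stmt3 (f g : E2 → E2)
    (hf : ContDiff ℝ (⊤ : ℕ∞) f) (hg : ContDiff ℝ (⊤ : ℕ∞) g) :
    ContDiffOn ℝ (⊤ : ℕ∞) (αfun f g) {x : E2 | det2 (f x) (g x) ≠ 0} ∧
    ∀ x : E2, det2 (f x) (g x) ≠ 0 → det2 (g x) (lieB f g x) = 0 →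
      det2 (g x) (lieB g (lieB f g) x)
        = -det2 (f x) (g x) * ⟪gradient (αfun f g) x, g x⟫ ∧
      det2 (g x) (lieB f (lieB f g) x)
        = -det2 (f x) (g x) * ⟪gradient (αfun f g) x, f x⟫ := by
  have hh := contDiff_lieB hf hg
  have hS := contDiff_det2 hg hh
  have hd := contDiff_det2 hf hg
  refine ⟨hS.neg.contDiffOn.div hd.contDiffOn fun x hx => hx, fun x hx hSx => ?_⟩
  have hne : ((⊤ : ℕ∞) : WithTop ℕ∞) ≠ 0 := by simp
  have key (v : E2) : -det2 (f x) (g x) * ⟪gradient (αfun f g) x, v⟫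
      = det2 (fderiv ℝ g x v) (lieB f g x) + det2 (g x) (fderiv ℝ (lieB f g) x v) := by
    rw [gradient, InnerProductSpace.toDual_symm_apply,
      ← fderiv_det2_apply (hg.differentiable hne x) (hh.differentiable hne x)]
    exact mul_fderiv_neg_div_apply (hS.differentiable hne x) (hd.differentiable hne x) hx hSx v
  obtain ⟨r, hr⟩ := exists_eq_smul_of_det2_eq_zero hx hSx
  constructor
  · rw [key, lieB, hr, map_smul]
    simp only [det2, PiLp.sub_apply, PiLp.smul_apply, smul_eq_mul]
    ring
  · have hSx' := hSx
    rw [lieB] at hSx'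
    rw [key, lieB, hr, map_smul]
    simp only [det2, PiLp.sub_apply, PiLp.smul_apply, smul_eq_mul] at hSx' ⊢
    linear_combination r * hSx'
end
end

section
/- Let x ∈ ℝ² satisfy δ₀(x) ≠ 0, δ_SA(x) = 0, and det(g(x),[g,[f,g]](x)) ≠ 0. Then ∇δ_SA(x)·(f(x)+g(x)) = det(g(x),[g,[f,g]](x))·(1 − ψ(x)) and ∇δ_SA(x)·(f(x)−g(x)) = det(g(x),[g,[f,g]](x))·(−1 − ψ(x)). -/
open scoped RealInnerProductSpace

noncomputable section

/-- `δ_SA(x) = det(g(x),[f,g](x))`. -/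
def δSA (f g : E2 → E2) (x : E2) : ℝ := det2 (g x) (lieB f g x)

/-- A linear map acts on `det2` as a derivation, with multiplier its trace. -/
lemma det2_map_add_det2_map (L : E2 →L[ℝ] E2) (a b : E2) :
    det2 (L a) b + det2 a (L b) =
      (L (EuclideanSpace.single 0 1) 0 + L (EuclideanSpace.single 1 1) 1) * det2 a b := by
  have hL : ∀ v : E2, L v =
      v 0 • L (EuclideanSpace.single 0 1) + v 1 • L (EuclideanSpace.single 1 1) := by
    intro v
    rw [← map_smul, ← map_smul, ← map_add]
    congr 1
    ext i
    fin_cases i <;> simp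
  rw [hL a, hL b]
  simp only [det2, PiLp.add_apply, PiLp.smul_apply, smul_eq_mul]
  ring

lemma inner_gradient_det2 {g h : E2 → E2} {x : E2} (hg : DifferentiableAt ℝ g x)
    (hh : DifferentiableAt ℝ h x) (v : E2) :
    ⟪gradient (fun y => det2 (g y) (h y)) x, v⟫ =
      det2 (fderiv ℝ g x v) (h x) + det2 (g x) (fderiv ℝ h x v) := by
  have hg' (i : Fin 2) := (EuclideanSpace.proj (𝕜 := ℝ) i).hasFDerivAt.comp x hg.hasFDerivAt
  have hh' (i : Fin 2) := (EuclideanSpace.proj (𝕜 := ℝ) i).hasFDerivAt.comp x hh.hasFDerivAt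
  have hd := ((hg' 0).mul (hh' 1)).sub ((hg' 1).mul (hh' 0))
  have hd' : fderiv ℝ (fun y => det2 (g y) (h y)) x = _ := hd.fderiv
  rw [gradient, InnerProductSpace.toDual_symm_apply, hd']
  simp [det2]
  ring

/-- if `δ₀(x) ≠ 0`, `δ_SA(x) = 0` and `det(g(x),[g,[f,g]](x)) ≠ 0`,
then `∇δ_SA(x)·(f(x)+g(x)) = det(g(x),[g,[f,g]](x))·(1 − ψ(x))` and
`∇δ_SA(x)·(f(x)−g(x)) = det(g(x),[g,[f,g]](x))·(−1 − ψ(x))`. -/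
theorem stmt7 (f g : E2 → E2)
    (hf : ContDiff ℝ (⊤ : ℕ∞) f) (hg : ContDiff ℝ (⊤ : ℕ∞) g)
    (x : E2) (hδ : det2 (f x) (g x) ≠ 0) (hsa : δSA f g x = 0)
    (hB : det2 (g x) (lieB g (lieB f g) x) ≠ 0) :
    ⟪gradient (δSA f g) x, f x + g x⟫
      = det2 (g x) (lieB g (lieB f g) x) * (1 - ψfb f g x) ∧
    ⟪gradient (δSA f g) x, f x - g x⟫
      = det2 (g x) (lieB g (lieB f g) x) * (-1 - ψfb f g x) := by
  have hh := contDiff_lieB hf hg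
  have hgrad : ∀ v, ⟪gradient (δSA f g) x, v⟫ = _ :=
    inner_gradient_det2 (hg.differentiable (by simp) x) (hh.differentiable (by simp) x)
  have hsa' : det2 (g x) (lieB f g x) = 0 := hsa
  have hgg : ⟪gradient (δSA f g) x, g x⟫ = det2 (g x) (lieB g (lieB f g) x) := by
    have htr := det2_map_add_det2_map (fderiv ℝ g x) (g x) (lieB f g x)
    rw [hsa', mul_zero] at htr
    rw [hgrad, lieB.eq_def g (lieB f g)]
    simp only [det2, PiLp.sub_apply] at htr ⊢
    linear_combination htr
  have hgf : ⟪gradient (δSA f g) x, f x⟫ = det2 (g x) (lieB f (lieB f g) x) := by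
    have htr := det2_map_add_det2_map (fderiv ℝ f x) (g x) (lieB f g x)
    rw [hsa', mul_zero] at htr
    have hbr : fderiv ℝ g x (f x) = lieB f g x + fderiv ℝ f x (g x) := by simp [lieB]
    rw [hgrad, hbr, lieB.eq_def f (lieB f g)]
    simp only [det2, PiLp.sub_apply, PiLp.add_apply] at htr ⊢
    linear_combination htr
  rw [inner_add_right, inner_sub_right, hgg, hgf, ψfb]
  constructor <;> field_simp <;> ring
end
end

section
/- Assume δ₀(x) ≠ 0 for every x ∈ ℝ². Let T > 0, let u : [0,T] → [−1,1] be measurable, and let x, p : [0,T] → ℝ² be absolutely continuous with ẋ(t) = f(x(t)) + u(t)g(x(t)), ṗ(t) = −(Df(x(t)) + u(t)Dg(x(t)))ᵀ p(t), and the normality condition p(t)·f(x(t)) + u(t)·p(t)·g(x(t)) = 1, all for a.e. t ∈ [0,T]. Then the switching function φ(t) := p(t)·g(x(t)) satisfies the ODE φ'(t) = (β(x(t)) − α(x(t))u(t))·φ(t) + α(x(t)) for a.e. t ∈ [0,T], where α(x) := −det(g(x),[f,g](x))/δ₀(x) and β(x) := det(f(x),[f,g](x))/δ₀(x). -/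
open Set MeasureTheory
open scoped RealInnerProductSpace

noncomputable section

/-- `β(x) = det(f(x),[f,g](x))/δ₀(x)`. -/
def βfun (f g : E2 → E2) (x : E2) : ℝ :=
  det2 (f x) (lieB f g x) / det2 (f x) (g x)

/-- The value at `p` of `−(Df(x) + u Dg(x))ᵀ`, the right-hand side of the
adjoint equation. -/
def adjRHS (f g : E2 → E2) (u : ℝ) (x p : E2) : E2 :=
  -(ContinuousLinearMap.adjoint (fderiv ℝ f x + u • fderiv ℝ g x)) p

/-- The fundamental theorem of calculus along a Lipschitz curve given in integral form. -/
theorem comp_eq_add_integral_fderiv {E : Type*} [NormedAddCommGroup E] [NormedSpace ℝ E]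
    [FiniteDimensional ℝ E] {Φ : E → ℝ} (hΦ : ContDiff ℝ 1 Φ) {z v : ℝ → E} {T C : ℝ}
    (hT : 0 ≤ T) (hv : IntegrableOn v (Icc 0 T)) (hC : ∀ s ∈ Icc 0 T, ‖v s‖ ≤ C)
    (hz : ∀ t ∈ Icc 0 T, z t = z 0 + ∫ s in (0:ℝ)..t, v s) :
    Φ (z T) = Φ (z 0) + ∫ s in (0:ℝ)..T, fderiv ℝ Φ (z s) (v s) := by
  have : ProperSpace E := FiniteDimensional.proper ℝ E
  have hvT : IntervalIntegrable v volume 0 T :=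
    (intervalIntegrable_iff_integrableOn_Icc_of_le hT).2 hv
  have hv0 : ∀ t ∈ Icc 0 T, IntervalIntegrable v volume 0 t := fun t ht ↦
    hvT.mono_set (by rw [uIcc_of_le ht.1, uIcc_of_le hT]; exact Icc_subset_Icc_right ht.2)
  have hC0 : 0 ≤ C := (norm_nonneg _).trans (hC 0 ⟨le_rfl, hT⟩)
  have hzlip : LipschitzOnWith C.toNNReal z (Icc 0 T) := by
    refine LipschitzOnWith.of_dist_le_mul fun a ha b hb ↦ ?_
    rw [dist_eq_norm, hz a ha, hz b hb, add_sub_add_left_eq_sub,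
      intervalIntegral.integral_interval_sub_left (hv0 a ha) (hv0 b hb), Real.coe_toNNReal _ hC0]
    refine intervalIntegral.norm_integral_le_of_norm_le_const fun s hs ↦ hC s ?_
    exact (convex_Icc 0 T).ordConnected.uIcc_subset hb ha (uIoc_subset_uIcc hs)
  obtain ⟨R, hR⟩ :=
    (isCompact_Icc.image_of_continuousOn hzlip.continuousOn).isBounded.subset_closedBall (0 : E)
  obtain ⟨K, hK⟩ := (hΦ.contDiffOn (s := Metric.closedBall 0 R)).exists_lipschitzOnWith one_ne_zero
    (convex_closedBall 0 R) (isCompact_closedBall 0 R)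
  have hac : AbsolutelyContinuousOnInterval (fun t ↦ Φ (z t)) 0 T := by
    refine LipschitzOnWith.absolutelyContinuousOnInterval (K := K * C.toNNReal) ?_
    rw [uIcc_of_le hT]
    exact hK.comp hzlip (mapsTo_iff_image_subset.2 hR)
  have hderiv : ∀ᵐ s, s ∈ uIoc 0 T → deriv (fun t ↦ Φ (z t)) s = fderiv ℝ Φ (z s) (v s) := by
    filter_upwards [hvT.ae_hasDerivAt_integral, Measure.ae_ne volume T] with s hs hsT hmem
    rw [uIoc_of_le hT] at hmem
    have hev : z =ᶠ[nhds s] fun t ↦ z 0 + ∫ r in (0:ℝ)..t, v r := by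
      filter_upwards [Icc_mem_nhds hmem.1 (lt_of_le_of_ne hmem.2 hsT)] with t ht using hz t ht
    have hzd : HasDerivAt z (v s) s :=
      ((hs (by rw [uIcc_of_le hT]; exact Ioc_subset_Icc_self hmem) 0 (by simp)).const_add
        (z 0)).congr_of_eventuallyEq hev
    exact ((hΦ.differentiable one_ne_zero (z s)).hasFDerivAt.comp_hasDerivAt s hzd).deriv
  rw [← intervalIntegral.integral_congr_ae hderiv, hac.integral_deriv_eq_sub]
  ring

/-- Cramer's rule for the Lie bracket in the frame `f`, `g`. -/
theorem lieB_eq_smul_add_smul {f g : E2 → E2} {x : E2} (h : det2 (f x) (g x) ≠ 0) :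
    lieB f g x = αfun f g x • f x + βfun f g x • g x := by
  ext i
  simp only [αfun, βfun, PiLp.add_apply, PiLp.smul_apply, smul_eq_mul]
  generalize lieB f g x = l
  generalize f x = a at *
  generalize g x = b at *
  rw [div_mul_eq_mul_div, div_mul_eq_mul_div, ← add_div, eq_div_iff h]
  fin_cases i <;> simp [det2] <;> ring

/-- The pairing of the costate with `g` differentiates to its pairing with `[f, g]` along the
Hamiltonian flow. -/
theorem fderiv_inner_adjRHS {f g : E2 → E2} (hg : Differentiable ℝ g) (c : ℝ) (x p : E2) :
    fderiv ℝ (fun z : E2 × E2 ↦ ⟪z.1, g z.2⟫) (p, x) (adjRHS f g c x p, f x + c • g x)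
      = ⟪p, lieB f g x⟫ := by
  have hg2 : HasFDerivAt (fun z : E2 × E2 ↦ g z.2)
      ((fderiv ℝ g x).comp (ContinuousLinearMap.snd ℝ E2 E2)) (p, x) :=
    (hg x).hasFDerivAt.comp (p, x) hasFDerivAt_snd
  rw [(hasFDerivAt_fst.inner ℝ hg2).fderiv]
  simp [adjRHS, lieB, ContinuousLinearMap.adjoint_inner_left, inner_add_right,
    inner_add_left, inner_smul_right, inner_smul_left, sub_eq_add_neg]

theorem continuous_adjRHS {f g : E2 → E2} (hf : ContDiff ℝ 1 f) (hg : ContDiff ℝ 1 g) :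
    Continuous fun y : (E2 × E2) × ℝ ↦ adjRHS f g y.2 y.1.2 y.1.1 := by
  have hf' := hf.continuous_fderiv one_ne_zero
  have hg' := hg.continuous_fderiv one_ne_zero
  have h : Continuous fun y : (E2 × E2) × ℝ ↦ fderiv ℝ f y.1.2 + y.2 • fderiv ℝ g y.1.2 := by
    fun_prop
  exact (((ContinuousLinearMap.adjoint (𝕜 := ℝ) (E := E2) (F := E2)).continuous.comp h).clm_apply
    (by fun_prop)).neg

/-- assume `δ₀ ≠ 0` everywhere. Along a normal extremal
(state and adjoint equations plus the normality identity
`p·f(x) + u p·g(x) = 1` a.e.), the switching function `φ(t) = p(t)·g(x(t))`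
satisfies the ODE `φ' = (β(x) − α(x)u)φ + α(x)` a.e. on `[0,T]`, expressed in
integral (absolutely continuous) form. -/
theorem stmt9 (f g : E2 → E2)
    (hf : ContDiff ℝ (⊤ : ℕ∞) f) (hg : ContDiff ℝ (⊤ : ℕ∞) g)
    (hδ : ∀ x : E2, det2 (f x) (g x) ≠ 0)
    (T : ℝ) (hT : 0 < T)
    (u : ℝ → ℝ) (hu : Measurable u) (hu1 : ∀ t ∈ Icc 0 T, u t ∈ Icc (-1:ℝ) 1)
    (x p : ℝ → E2)
    (hxc : ContinuousOn x (Icc 0 T)) (hpc : ContinuousOn p (Icc 0 T))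
    (hx : ∀ t ∈ Icc 0 T, x t = x 0 + ∫ s in (0:ℝ)..t, (f (x s) + u s • g (x s)))
    (hp : ∀ t ∈ Icc 0 T, p t = p 0 + ∫ s in (0:ℝ)..t, adjRHS f g (u s) (x s) (p s))
    (hnormal : ∀ᵐ t ∂(volume.restrict (Icc 0 T)),
      ⟪p t, f (x t)⟫ + u t * ⟪p t, g (x t)⟫ = 1) :
    ∀ t ∈ Icc 0 T,
      ⟪p t, g (x t)⟫ = ⟪p 0, g (x 0)⟫ +
        ∫ s in (0:ℝ)..t,
          ((βfun f g (x s) - αfun f g (x s) * u s) * ⟪p s, g (x s)⟫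
            + αfun f g (x s)) := by
  intro t ht
  have hf1 : ContDiff ℝ 1 f := hf.of_le (by exact_mod_cast le_top)
  have hg1 : ContDiff ℝ 1 g := hg.of_le (by exact_mod_cast le_top)
  have hsub : Icc 0 t ⊆ Icc 0 T := Icc_subset_Icc_right ht.2
  let F : (E2 × E2) × ℝ → E2 × E2 := fun y ↦
    (adjRHS f g y.2 y.1.2 y.1.1, f y.1.2 + y.2 • g y.1.2)
  have hF : Continuous F := by
    have hfc := hf.continuous
    have hgc := hg.continuous
    exact (continuous_adjRHS hf1 hg1).prodMk (by fun_prop)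
  have hzc : ContinuousOn (fun s ↦ (p s, x s)) (Icc 0 t) := (hpc.prodMk hxc).mono hsub
  have hv : AEStronglyMeasurable (fun s ↦ F ((p s, x s), u s)) (volume.restrict (Icc 0 t)) :=
    hF.comp_aestronglyMeasurable
      ((hzc.aestronglyMeasurable measurableSet_Icc).prodMk hu.aestronglyMeasurable)
  obtain ⟨C, hC⟩ := ((isCompact_Icc.image_of_continuousOn hzc).prod
    (isCompact_Icc (a := (-1 : ℝ)) (b := 1))).exists_bound_of_continuousOn hF.continuousOn
  have hC' : ∀ s ∈ Icc 0 t, ‖F ((p s, x s), u s)‖ ≤ C := fun s hs ↦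
    hC _ ⟨mem_image_of_mem _ hs, hu1 s (hsub hs)⟩
  have hint : IntegrableOn (fun s ↦ F ((p s, x s), u s)) (Icc 0 t) :=
    Integrable.of_bound hv C
      ((ae_restrict_iff' measurableSet_Icc).2 (.of_forall hC'))
  have hz : ∀ r ∈ Icc 0 t, (p r, x r) = (p 0, x 0) + ∫ s in (0:ℝ)..r, F ((p s, x s), u s) := by
    intro r hr
    have hr' : IntervalIntegrable (fun s ↦ F ((p s, x s), u s)) volume 0 r :=
      (intervalIntegrable_iff_integrableOn_Icc_of_le hr.1).2
        (hint.mono_set (Icc_subset_Icc_right hr.2))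
    ext1
    · rw [Prod.fst_add, hp r (hsub hr)]
      exact congrArg (_ + ·)
        ((ContinuousLinearMap.fst ℝ E2 E2).intervalIntegral_comp_comm hr')
    · rw [Prod.snd_add, hx r (hsub hr)]
      exact congrArg (_ + ·)
        ((ContinuousLinearMap.snd ℝ E2 E2).intervalIntegral_comp_comm hr')
  have hΦ : ContDiff ℝ 1 fun z : E2 × E2 ↦ ⟪z.1, g z.2⟫ :=
    contDiff_fst.inner ℝ (hg1.comp contDiff_snd)
  refine (comp_eq_add_integral_fderiv hΦ ht.1 hint hC' hz).trans ?_
  congr 1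
  refine intervalIntegral.integral_congr_ae ?_
  filter_upwards [(ae_restrict_iff' measurableSet_Icc).1 hnormal] with s hs hmem
  rw [uIoc_of_le ht.1] at hmem
  have hn := hs (hsub (Ioc_subset_Icc_self hmem))
  rw [fderiv_inner_adjRHS (hg1.differentiable one_ne_zero), lieB_eq_smul_add_smul (hδ (x s)),
    inner_add_right, inner_smul_right, inner_smul_right]
  linear_combination αfun f g (x s) * hn
end
end

section
/- Suppose Assumption A3 holds at a solution (t_b*, z_b*, λ*) of F = 0. Then there exist ε > 0 and a C¹ map σ : (t_b*−ε, t_b*+ε) → ℝ⁴ × ℝᵏ, σ(t_b) = (z_b(t_b), λ(t_b)), such that G(t_b, σ(t_b)) = 0 for all t_b ∈ (t_b*−ε, t_b*+ε), σ(t_b*) = (z_b*, λ*), and σ'(t_b*) = 0. -/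
open Set
open scoped RealInnerProductSpace

noncomputable section

/-- The cotangent bundle `ℝ² × ℝ² ≅ ℝ⁴`; `z = (x,p)`. -/
abbrev Z4 : Type := E2 × E2

/-- Hamiltonian lift `H_h(z) = p·h(x)`. -/
def Hlift (h : E2 → E2) (z : Z4) : ℝ := ⟪z.2, h z.1⟫

/-- The Hamiltonian vector field of `H₊ = H_f + H_g`:
`H⃗₊(x,p) = ((f+g)(x), −(Df(x)+Dg(x))ᵀ p)`. -/
def HvecPlus (f g : E2 → E2) (z : Z4) : Z4 :=
  (f z.1 + g z.1,
   -(ContinuousLinearMap.adjoint (fderiv ℝ f z.1 + fderiv ℝ g z.1)) z.2)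

/-- The map `G(t_b,z_b,λ) = (H_g(exp(−t_b H⃗₊)(z_b)), H₊(z_b) − 1, Ψ(z_b,λ))`,
with the normal multiplier `p⁰ = −1`. -/
def Gmap (f g : E2 → E2) (Φ : ℝ → Z4 → Z4) (k : ℕ)
    (Ψ : Z4 → EuclideanSpace ℝ (Fin k) → EuclideanSpace ℝ (Fin (2+k)))
    (tb : ℝ) (zb : Z4) (lam : EuclideanSpace ℝ (Fin k)) :
    ℝ × ℝ × EuclideanSpace ℝ (Fin (2+k)) :=
  (Hlift g (Φ (-tb) zb), Hlift (fun x => f x + g x) zb - 1, Ψ zb lam)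

/-- The map `F(t_b,z_b,λ) = (H_{[f,g]}(exp(−t_b H⃗₊)(z_b)), G(t_b,z_b,λ))`. -/
def Fmap (f g : E2 → E2) (Φ : ℝ → Z4 → Z4) (k : ℕ)
    (Ψ : Z4 → EuclideanSpace ℝ (Fin k) → EuclideanSpace ℝ (Fin (2+k)))
    (tb : ℝ) (zb : Z4) (lam : EuclideanSpace ℝ (Fin k)) :
    ℝ × ℝ × ℝ × EuclideanSpace ℝ (Fin (2+k)) :=
  (Hlift (lieB f g) (Φ (-tb) zb), Gmap f g Φ k Ψ tb zb lam)

/-- The derivative of `H_g` along an integral curve of `H⃗₊` is `H_{[f,g]}`. -/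
theorem hasDerivAt_Hlift_of_integralCurve {f g : E2 → E2} {γ : ℝ → Z4} {t : ℝ}
    (hg : DifferentiableAt ℝ g (γ t).1) (hγ : HasDerivAt γ (HvecPlus f g (γ t)) t) :
    HasDerivAt (fun s => Hlift g (γ s)) (Hlift (lieB f g) (γ t)) t := by
  have h1 : HasDerivAt (fun s => (γ s).1) (HvecPlus f g (γ t)).1 t := hγ.fst
  have h2 : HasDerivAt (fun s => (γ s).2) (HvecPlus f g (γ t)).2 t := hγ.snd
  have h3 : HasDerivAt (fun s => g (γ s).1)
      (fderiv ℝ g (γ t).1 (HvecPlus f g (γ t)).1) t :=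
    hg.hasFDerivAt.comp_hasDerivAt t h1
  refine (h2.inner ℝ h3).congr_deriv ?_
  simp only [Hlift, lieB, HvecPlus, inner_neg_left, inner_add_left,
    map_add, add_apply, inner_add_right, inner_sub_right, ContinuousLinearMap.adjoint_inner_left]
  ring

theorem contDiff_Hlift {n : WithTop ℕ∞} {h : E2 → E2} (hh : ContDiff ℝ n h) :
    ContDiff ℝ n (Hlift h) :=
  contDiff_snd.inner ℝ (hh.comp contDiff_fst)

theorem contDiff_Gmap {n : WithTop ℕ∞} {f g : E2 → E2} {Φ : ℝ → Z4 → Z4} {k : ℕ}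
    {Ψ : Z4 → EuclideanSpace ℝ (Fin k) → EuclideanSpace ℝ (Fin (2 + k))}
    (hf : ContDiff ℝ n f) (hg : ContDiff ℝ n g)
    (hΦ : ContDiff ℝ n (fun q : ℝ × Z4 => Φ q.1 q.2))
    (hΨ : ContDiff ℝ n (fun q : Z4 × EuclideanSpace ℝ (Fin k) => Ψ q.1 q.2)) :
    ContDiff ℝ n (fun q : ℝ × Z4 × EuclideanSpace ℝ (Fin k) =>
      Gmap f g Φ k Ψ q.1 q.2.1 q.2.2) := by
  have hΦ' : ContDiff ℝ n
      (fun q : ℝ × Z4 × EuclideanSpace ℝ (Fin k) => Φ (-q.1) q.2.1) :=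
    hΦ.comp (contDiff_fst.neg.prodMk contDiff_snd.fst)
  exact ((contDiff_Hlift hg).comp hΦ').prodMk
    ((((contDiff_Hlift (hf.add hg)).comp contDiff_snd.fst).sub contDiff_const).prodMk
      (hΨ.comp contDiff_snd))

/-- At a zero of `H_{[f,g]}(exp(−t_b H⃗₊)(z_b))`, the partial derivative of `G` in `t_b`
vanishes. -/
theorem hasDerivAt_Gmap_zero {f g : E2 → E2} {Φ : ℝ → Z4 → Z4} {k : ℕ}
    {Ψ : Z4 → EuclideanSpace ℝ (Fin k) → EuclideanSpace ℝ (Fin (2 + k))}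
    {t : ℝ} {z : Z4} {lam : EuclideanSpace ℝ (Fin k)}
    (hg : DifferentiableAt ℝ g (Φ (-t) z).1)
    (hΦ : HasDerivAt (fun s => Φ s z) (HvecPlus f g (Φ (-t) z)) (-t))
    (h0 : Hlift (lieB f g) (Φ (-t) z) = 0) :
    HasDerivAt (fun s => Gmap f g Φ k Ψ s z lam) 0 t := by
  have h1 := hasDerivAt_Hlift_of_integralCurve hg hΦ
  rw [h0] at h1
  have h2 : HasDerivAt (fun s => Hlift g (Φ (-s) z)) 0 t := by
    simpa [Function.comp_def] using h1.scomp t (hasDerivAt_neg t)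
  exact h2.prodMk (hasDerivAt_const t _)

/-- Implicit function theorem over a real parameter: if the derivative in the parameter
vanishes at the base point, then so does the derivative of the implicit function. -/
theorem exists_contDiffOn_implicit_of_hasDerivAt_zero
    {E F : Type*} [NormedAddCommGroup E] [NormedSpace ℝ E] [CompleteSpace E]
    [NormedAddCommGroup F] [NormedSpace ℝ F] [CompleteSpace F]
    {G : ℝ × E → F} {t : ℝ} {x : E} (hG : ContDiffAt ℝ 1 G (t, x))
    (hbij : Function.Bijective (fderiv ℝ (fun y => G (t, y)) x))
    (ht : HasDerivAt (fun s => G (s, x)) 0 t) :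
    ∃ ε : ℝ, 0 < ε ∧ ∃ σ : ℝ → E,
      ContDiffOn ℝ 1 σ (Ioo (t - ε) (t + ε)) ∧
      (∀ s ∈ Ioo (t - ε) (t + ε), G (s, σ s) = G (t, x)) ∧
      σ t = x ∧ HasDerivAt σ 0 t := by
  have hd : HasFDerivAt G (fderiv ℝ G (t, x)) (t, x) :=
    (hG.differentiableAt one_ne_zero).hasFDerivAt
  have hr : fderiv ℝ (fun y => G (t, y)) x = fderiv ℝ G (t, x) ∘L .inr ℝ ℝ E :=
    (hd.comp x (hasFDerivAt_prodMk_right t x)).fderiv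
  have hl : fderiv ℝ G (t, x) ∘L .inl ℝ ℝ E = 0 := by
    refine (hd.comp t (hasFDerivAt_prodMk_left t x)).unique (ht.hasFDerivAt.congr_fderiv ?_)
    ext
    simp
  rw [hr] at hbij
  have hinv : (fderiv ℝ G (t, x) ∘L .inr ℝ ℝ E).IsInvertible :=
    ⟨ContinuousLinearEquiv.ofBijective _ (LinearMap.ker_eq_bot.2 hbij.1)
      (LinearMap.range_eq_top.2 hbij.2), ContinuousLinearEquiv.coe_ofBijective _ _ _⟩
  have hev := (hG.eventually_apply_implicitFunction one_ne_zero hinv).and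
    ((hG.contDiffAt_implicitFunction one_ne_zero hinv).eventually (by simp))
  obtain ⟨ε, hε, hball⟩ := Metric.eventually_nhds_iff_ball.1 hev
  rw [Real.ball_eq_Ioo] at hball
  refine ⟨ε, hε, hG.implicitFunction one_ne_zero hinv,
    fun s hs => (hball s hs).2.contDiffWithinAt, fun s hs => (hball s hs).1,
    hG.implicitFunction_apply_self one_ne_zero hinv, ?_⟩
  have h := (hG.hasStrictFDerivAt_implicitFunction one_ne_zero hinv).hasFDerivAt.hasDerivAt
  simpa [hl] using h

/-- Lemma `lmm:switching_curve`: under Assumption A3, the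
equation `G(t_b, σ(t_b)) = 0` has a local `C¹` implicit solution
`σ(t_b) = (z_b(t_b), λ(t_b))` near `t_b*` with `σ(t_b*) = (z_b*, λ*)` and
`σ'(t_b*) = 0`. -/
theorem stmt15 (f g : E2 → E2)
    (hf : ContDiff ℝ (⊤ : ℕ∞) f) (hg : ContDiff ℝ (⊤ : ℕ∞) g)
    (k : ℕ) (Ψ : Z4 → EuclideanSpace ℝ (Fin k) → EuclideanSpace ℝ (Fin (2+k)))
    (hΨ : ContDiff ℝ (⊤ : ℕ∞) (fun q : Z4 × EuclideanSpace ℝ (Fin k) => Ψ q.1 q.2))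
    -- the complete flow Φ of H⃗₊
    (Φ : ℝ → Z4 → Z4)
    (hΦsmooth : ContDiff ℝ (⊤ : ℕ∞) (fun q : ℝ × Z4 => Φ q.1 q.2))
    (hΦ0 : ∀ z : Z4, Φ 0 z = z)
    (hΦd : ∀ (t : ℝ) (z : Z4), HasDerivAt (fun s => Φ s z) (HvecPlus f g (Φ t z)) t)
    -- the solution of F = 0
    (tbs : ℝ) (zbs : Z4) (lams : EuclideanSpace ℝ (Fin k))
    (hsol : Fmap f g Φ k Ψ tbs zbs lams = 0)
    -- Assumption A3
    (hA3 : Function.Bijective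
      (fderiv ℝ (fun q : Z4 × EuclideanSpace ℝ (Fin k) =>
        Gmap f g Φ k Ψ tbs q.1 q.2) (zbs, lams))) :
    ∃ ε : ℝ, 0 < ε ∧
      ∃ σ : ℝ → Z4 × EuclideanSpace ℝ (Fin k),
        ContDiffOn ℝ 1 σ (Ioo (tbs - ε) (tbs + ε)) ∧
        (∀ tb ∈ Ioo (tbs - ε) (tbs + ε),
          Gmap f g Φ k Ψ tb (σ tb).1 (σ tb).2 = 0) ∧
        σ tbs = (zbs, lams) ∧
        HasDerivAt σ 0 tbs := by
  have hlie : Hlift (lieB f g) (Φ (-tbs) zbs) = 0 := congrArg Prod.fst hsol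
  have hG0 : Gmap f g Φ k Ψ tbs zbs lams = 0 := congrArg Prod.snd hsol
  have hG := ((contDiff_Gmap hf hg hΦsmooth hΨ).of_le
    (by exact_mod_cast le_top : (1 : WithTop ℕ∞) ≤ ((⊤ : ℕ∞) : WithTop ℕ∞))).contDiffAt
      (x := (tbs, zbs, lams))
  have hgd : Differentiable ℝ g := hg.differentiable (by simp)
  obtain ⟨ε, hε, σ, hσ, hσG, hσ0, hσ'⟩ := exists_contDiffOn_implicit_of_hasDerivAt_zero hG hA3
    (hasDerivAt_Gmap_zero (hgd _) (hΦd _ _) hlie)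
  exact ⟨ε, hε, σ, hσ, fun s hs => (hσG s hs).trans hG0, hσ0, hσ'⟩
end
end
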